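/- (Lemma: upper bound on the dual norm of the SGLIG regularizer.) Assume τ_i ≥ √(d_i) for every i ∈ {1,…,p}, and let d_min = min_{1≤i≤p} d_i. Then for every u ∈ ℝ^p, the dual norm R*(u) = sup { ⟨β, u⟩ : β ∈ ℝ^p, R(β) ≤ 1 } satisfies R*(u) ≤ (1/√(d_min)) · max_{1≤i≤p} ‖u_{N_i}‖₂. -/

import Mathlib

open scoped BigOperators

/-- Euclidean (ℓ₂) norm of a vector in ℝ^p. -/
noncomputable def l2 {p : ℕ} (v : Fin p → ℝ) : ℝ := Real.sqrt (∑ j, v j ^ 2)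

/-- ℓ₁ norm of a vector in ℝ^p. -/
noncomputable def l1 {p : ℕ} (v : Fin p → ℝ) : ℝ := ∑ j, |v j|

/-- The SGLIG regularizer
`R(β) = inf { ∑ᵢ (α τᵢ ‖V⁽ⁱ⁾‖₂ + (1−α) √dᵢ ‖V⁽ⁱ⁾‖₁) : supp V⁽ⁱ⁾ ⊆ Nᵢ, ∑ᵢ V⁽ⁱ⁾ = β }`,
where `dᵢ = |Nᵢ|`. -/
noncomputable def Rreg {p : ℕ} (N : Fin p → Finset (Fin p)) (τ : Fin p → ℝ) (α : ℝ)
    (β : Fin p → ℝ) : ℝ :=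
  sInf { r : ℝ | ∃ V : Fin p → Fin p → ℝ,
    (∀ i, ∀ j, j ∉ N i → V i j = 0) ∧ (∑ i, V i) = β ∧
    r = ∑ i, (α * τ i * l2 (V i) + (1 - α) * Real.sqrt ((N i).card) * l1 (V i)) }

/-- The vector agreeing with `v` on the coordinate set `s` and equal to 0 elsewhere. -/
def restr {p : ℕ} (s : Finset (Fin p)) (v : Fin p → ℝ) : Fin p → ℝ :=
  fun j => if j ∈ s then v j else 0

theorem l2_nonneg {p : ℕ} (v : Fin p → ℝ) : 0 ≤ l2 v := Real.sqrt_nonneg _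

theorem l2_le_l1 {p : ℕ} (v : Fin p → ℝ) : l2 v ≤ l1 v := by
  have h : ∑ j, |v j| ^ 2 ≤ (∑ j, |v j|) ^ 2 :=
    Finset.sum_sq_le_sq_sum_of_nonneg fun j _ => abs_nonneg (v j)
  refine Real.sqrt_le_iff.mpr ⟨Finset.sum_nonneg fun j _ => abs_nonneg (v j), ?_⟩
  simpa only [sq_abs, l1] using h

theorem sum_mul_le_l2_mul_l2_restr {p : ℕ} {s : Finset (Fin p)} {v : Fin p → ℝ}
    (hv : ∀ j, j ∉ s → v j = 0) (u : Fin p → ℝ) :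
    ∑ j, v j * u j ≤ l2 v * l2 (restr s u) := by
  have h : ∑ j, v j * u j = ∑ j, v j * restr s u j := by
    refine Finset.sum_congr rfl fun j _ => ?_
    by_cases hj : j ∈ s <;> simp [restr, hj, hv]
  rw [h]
  exact Real.sum_mul_le_sqrt_mul_sqrt _ _ _

/-- Each summand of the SGLIG cost dominates `√c ‖v‖₂` when `c ≤ d` and `√d ≤ t`. -/
theorem sqrt_mul_l2_le_cost {p : ℕ} {c d : ℕ} {t α : ℝ} (hcd : c ≤ d)
    (ht : Real.sqrt d ≤ t) (hα : 0 ≤ α ∧ α ≤ 1) (v : Fin p → ℝ) :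
    Real.sqrt c * l2 v ≤ α * t * l2 v + (1 - α) * Real.sqrt d * l1 v := by
  have hc : Real.sqrt c ≤ Real.sqrt d := Real.sqrt_le_sqrt (by exact_mod_cast hcd)
  have h₁ : α * Real.sqrt c * l2 v ≤ α * t * l2 v :=
    mul_le_mul_of_nonneg_right (mul_le_mul_of_nonneg_left (hc.trans ht) hα.1) (l2_nonneg v)
  have hα' : 0 ≤ 1 - α := sub_nonneg.mpr hα.2
  have h₂ : (1 - α) * Real.sqrt c * l2 v ≤ (1 - α) * Real.sqrt d * l1 v :=
    mul_le_mul (mul_le_mul_of_nonneg_left hc hα') (l2_le_l1 v) (l2_nonneg v) (by positivity)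
  linarith

/-- The pairing `⟨β, u⟩` is bounded by `R(β)` times the largest local norm of `u`. -/
theorem sqrt_mul_sum_mul_le_mul_Rreg {p : ℕ} {N : Fin p → Finset (Fin p)} (hN : ∀ i, i ∈ N i)
    {τ : Fin p → ℝ} {α : ℝ} (hα : 0 ≤ α ∧ α ≤ 1)
    (hτd : ∀ i, Real.sqrt ((N i).card) ≤ τ i) {c : ℕ} (hc : ∀ i, c ≤ (N i).card)
    {u : Fin p → ℝ} {M : ℝ} (hM : 0 ≤ M) (hu : ∀ i, l2 (restr (N i) u) ≤ M)
    (β : Fin p → ℝ) :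
    Real.sqrt c * ∑ j, β j * u j ≤ M * Rreg N τ α β := by
  rw [Rreg, ← smul_eq_mul M, ← Real.sInf_smul_of_nonneg hM]
  refine le_csInf (Set.Nonempty.smul_set ⟨_, fun i => Pi.single i (β i), fun i j hj => ?_,
    Finset.univ_sum_single β, rfl⟩) ?_
  · exact Pi.single_eq_of_ne (fun h : j = i => hj (h ▸ hN i)) _
  · rintro _ ⟨_, ⟨V, hV, rfl, rfl⟩, rfl⟩
    have hswap : ∑ j, (∑ i, V i) j * u j = ∑ i, ∑ j, V i j * u j := by
      simp only [Finset.sum_apply, Finset.sum_mul]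
      exact Finset.sum_comm
    simp only [smul_eq_mul]
    rw [hswap, Finset.mul_sum, Finset.mul_sum]
    refine Finset.sum_le_sum fun i _ => ?_
    calc Real.sqrt c * ∑ j, V i j * u j
        ≤ Real.sqrt c * (l2 (V i) * M) :=
          mul_le_mul_of_nonneg_left ((sum_mul_le_l2_mul_l2_restr (hV i) u).trans
            (mul_le_mul_of_nonneg_left (hu i) (l2_nonneg _))) (Real.sqrt_nonneg _)
      _ = M * (Real.sqrt c * l2 (V i)) := by ring
      _ ≤ _ := mul_le_mul_of_nonneg_left (sqrt_mul_l2_le_cost (hc i) (hτd i) hα _) hM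

/-- upper bound on the dual norm of the SGLIG regularizer: if
`τᵢ ≥ √dᵢ` for every `i` and `d_min = minᵢ dᵢ`, then for every `u`,
`R*(u) = sup { ⟨β, u⟩ : R(β) ≤ 1 } ≤ (1/√d_min) · maxᵢ ‖u_{Nᵢ}‖₂`. -/
theorem stmt9 {p : ℕ} (hp : 0 < p) (N : Fin p → Finset (Fin p)) (hN : ∀ i, i ∈ N i)
    (τ : Fin p → ℝ) (hτ : ∀ i, 0 < τ i)
    (α : ℝ) (hα : 0 ≤ α ∧ α ≤ 1)
    (hτd : ∀ i, Real.sqrt ((N i).card) ≤ τ i)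
    (dmin : ℕ) (hdmin : IsLeast (Set.range fun i => (N i).card) dmin)
    (u : Fin p → ℝ) :
    sSup { r : ℝ | ∃ β : Fin p → ℝ, Rreg N τ α β ≤ 1 ∧ r = ∑ j, β j * u j }
      ≤ (1 / Real.sqrt dmin) * (⨆ i, l2 (restr (N i) u)) := by
  have hM : 0 ≤ ⨆ i, l2 (restr (N i) u) := Real.iSup_nonneg fun i => l2_nonneg _
  have hu : ∀ i, l2 (restr (N i) u) ≤ ⨆ i, l2 (restr (N i) u) :=
    le_ciSup (Set.finite_range _).bddAbove
  have hc : ∀ i, dmin ≤ (N i).card := fun i => hdmin.2 ⟨i, rfl⟩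
  have hpos : 0 < Real.sqrt dmin := by
    obtain ⟨i, rfl⟩ := hdmin.1
    exact Real.sqrt_pos.mpr (Nat.cast_pos.mpr (Finset.card_pos.mpr ⟨i, hN i⟩))
  refine Real.sSup_le ?_ (mul_nonneg (by positivity) hM)
  rintro _ ⟨β, hβ, rfl⟩
  rw [one_div, inv_mul_eq_div, le_div_iff₀' hpos]
  exact (sqrt_mul_sum_mul_le_mul_Rreg hN hα hτd hc hM hu β).trans
    (mul_le_of_le_one_right hM hβ)
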